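/- Positivity preservation of the interpolant: the operator Π_{𝒯_𝒴} defined nodewise by 𝓛_{𝒯_𝒴} at nodes with v″ > 0 and by ℛ_{𝒯_Ω} applied to w(·,0) at nodes on Ω×{0} preserves nonnegativity of traces: if w ∈ W¹₁(𝒞_𝒴) is such that tr w ≥ 0 a.e. in Ω, then tr Π_{𝒯_𝒴} w ≥ 0 in Ω. This holds because the smoothing kernel μ₁ is nonnegative, so every nodal value ℛ_{𝒯_Ω}(tr w)(v′) = ∫ μ_{1,v′}(z′) tr w(z′) dz′ is nonnegative, and the Lagrange basis functions of the piecewise (multi)linear space on 𝒯_Ω are nonnegative. -/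

import Mathlib

open MeasureTheory Set

noncomputable section

/-- Points of the base domain `Ω ⊂ ℝ^d`. -/
abbrev Pt (d : ℕ) := EuclideanSpace ℝ (Fin d)

/-- Points of the (semi-infinite or truncated) cylinder `𝒞 = Ω × (0,∞)`. -/
abbrev Cy (d : ℕ) := EuclideanSpace ℝ (Fin d) × ℝ

variable {d : ℕ}

/-- The horizontal unit directions in the cylinder. -/
def ex (i : Fin d) : Cy d := (EuclideanSpace.single i 1, 0)

/-- The extended (vertical) unit direction in the cylinder. -/
def ey : Cy d := (0, 1)

/-- Directional derivative. -/
def pderiv (w : Cy d → ℝ) (p v : Cy d) : ℝ := fderiv ℝ w p v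

/-- Second directional derivative. -/
def D2 (w : Cy d → ℝ) (p v₁ v₂ : Cy d) : ℝ :=
  fderiv ℝ (fun q => fderiv ℝ w q v₁) p v₂

/-- `|∇w|²` at a point of the cylinder. -/
def gradSq (w : Cy d → ℝ) (p : Cy d) : ℝ :=
  (∑ i, (pderiv w p (ex i)) ^ 2) + (pderiv w p ey) ^ 2

/-- `∇w · ∇v` at a point of the cylinder. -/
def gradDot (w v : Cy d → ℝ) (p : Cy d) : ℝ :=
  (∑ i, pderiv w p (ex i) * pderiv v p (ex i)) + pderiv w p ey * pderiv v p ey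

/-- Trace on `Ω × {0}`. -/
def trc (w : Cy d → ℝ) : Pt d → ℝ := fun x => w (x, 0)

/-- Piecewise constant interpolant `W̄^τ` of a sequence, time step `τ = T/K`:
`W̄^τ(t) = W^{k+1}` for `t ∈ (t_k, t_{k+1}]`. -/
def pwConst {X : Type*} (T : ℝ) (K : ℕ) (V : ℕ → X) : ℝ → X :=
  fun t => V ⌈t * K / T⌉₊

/-- Piecewise linear interpolant `Ŵ^τ` of a sequence, time step `τ = T/K`. -/
def pwLinear {X : Type*} [AddCommGroup X] [Module ℝ X] (T : ℝ) (K : ℕ) (V : ℕ → X) : ℝ → X :=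
  fun t =>
    V ⌊t * K / T⌋₊ +
      (t * K / T - (⌊t * K / T⌋₊ : ℝ)) • (V (⌊t * K / T⌋₊ + 1) - V ⌊t * K / T⌋₊)

/-- Abstract analytic setting for the parabolic fractional obstacle problem on a bounded
convex polytopal domain `Ω ⊂ ℝ^d`, `s ∈ (0,1)`, final time `T`.  The Hilbert scale
`ℍ^σ(Ω)` of the Dirichlet Laplacian (with its norms), the spectral fractional Laplacian
`(−Δ)ˢ`, the `ℍ^{-s}–ℍ^{s}` duality pairing and the notion of `α`-harmonicity on
truncated cylinders are abstract data of the setting. -/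
structure Setting (d : ℕ) where
  Ω : Set (Pt d)
  hd : 1 ≤ d
  hΩop : IsOpen Ω
  hΩbd : Bornology.IsBounded Ω
  hΩcx : Convex ℝ Ω
  hΩne : Ω.Nonempty
  s : ℝ
  hs : s ∈ Ioo (0 : ℝ) 1
  T : ℝ
  hT : 0 < T
  /-- the Hilbert scale `σ ↦ ℍ^σ(Ω)`;  `ℍˢ(Ω) = Hg s`, `ℍ^{1+s}(Ω) = Hg (1+s)`, … -/
  Hg : ℝ → Set (Pt d → ℝ)
  /-- the norms of the Hilbert scale -/
  normHg : ℝ → (Pt d → ℝ) → ℝ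
  /-- the spectral fractional Laplacian `(−Δ)ˢ` -/
  fracLap : (Pt d → ℝ) → (Pt d → ℝ)
  /-- the `ℍ^{-s}(Ω)–ℍ^{s}(Ω)` duality pairing -/
  pair : (Pt d → ℝ) → (Pt d → ℝ) → ℝ
  /-- `alphaHarmonic Y w` : `div(y^α ∇w) = 0` in `𝒞_Y = Ω × (0,Y)` -/
  alphaHarmonic : ℝ → (Cy d → ℝ) → Prop

namespace Setting

variable (S : Setting d)

/-- `α = 1 − 2s`. -/
def α : ℝ := 1 - 2 * S.s

/-- The normalization constant `d_s = 2^α Γ(1−s)/Γ(s)`. -/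
def ds : ℝ := 2 ^ S.α * Real.Gamma (1 - S.s) / Real.Gamma S.s

/-- Lebesgue measure restricted to `Ω`. -/
def μΩ : Measure (Pt d) := volume.restrict S.Ω

/-- `L²(Ω)` norm. -/
def normL2 (w : Pt d → ℝ) : ℝ := Real.sqrt (∫ x in S.Ω, (w x) ^ 2)

/-- `L²(Ω)` inner product. -/
def ipL2 (w v : Pt d → ℝ) : ℝ := ∫ x in S.Ω, w x * v x

/-- `‖∇w‖_{L²(y^α, Ω × I)}`. -/
def gradNorm (I : Set ℝ) (w : Cy d → ℝ) : ℝ :=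
  Real.sqrt (∫ p in S.Ω ×ˢ I, p.2 ^ S.α * gradSq w p)

/-- The Dirichlet form `a_I(w,v) = d_s⁻¹ ∫_{Ω×I} y^α ∇w·∇v`. -/
def aForm (I : Set ℝ) (w v : Cy d → ℝ) : ℝ :=
  (1 / S.ds) * ∫ p in S.Ω ×ˢ I, p.2 ^ S.α * gradDot w v p

/-- Weighted `H¹(y^α, Ω×I)` functions vanishing on the lateral boundary. -/
def HL (I : Set ℝ) : Set (Cy d → ℝ) :=
  {w | IntegrableOn (fun p => p.2 ^ S.α * ((w p) ^ 2 + gradSq w p)) (S.Ω ×ˢ I) volume ∧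
       ∀ p ∈ (frontier S.Ω) ×ˢ I, w p = 0}

/-- `H̊¹_L(y^α, 𝒞)` on the full cylinder. -/
def HLfull : Set (Cy d → ℝ) := S.HL (Ioi 0)

/-- `H̊¹_L(y^α, 𝒞_Y)` on the truncated cylinder (vanishing also on the top `Ω×{Y}`). -/
def HLtrunc (Y : ℝ) : Set (Cy d → ℝ) :=
  {w ∈ S.HL (Ioo 0 Y) | ∀ x ∈ S.Ω, w (x, Y) = 0}

/-- The convex admissible set `𝒦(Ω)`. -/
def Kdom (ψ : Pt d → ℝ) : Set (Pt d → ℝ) :=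
  {w ∈ S.Hg S.s | ∀ᵐ x ∂S.μΩ, ψ x ≤ w x}

/-- The convex admissible set `𝒦(𝒞)` on the full cylinder. -/
def Kfull (ψ : Pt d → ℝ) : Set (Cy d → ℝ) :=
  {w ∈ S.HLfull | ∀ᵐ x ∂S.μΩ, ψ x ≤ trc w x}

/-- The convex admissible set `𝒦(𝒞_Y)` on the truncated cylinder. -/
def Ktrunc (Y : ℝ) (ψ : Pt d → ℝ) : Set (Cy d → ℝ) :=
  {w ∈ S.HLtrunc Y | ∀ᵐ x ∂S.μΩ, ψ x ≤ trc w x}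

/-- `‖f‖_{L²(0,T;L²(Ω))}`. -/
def normL2L2 (f : ℝ → Pt d → ℝ) : ℝ :=
  Real.sqrt (∫ t in Ioo 0 S.T, (S.normL2 (f t)) ^ 2)

/-- `‖u‖_{L∞(0,T;L²(Ω))}`. -/
def normLinfL2 (u : ℝ → Pt d → ℝ) : ℝ :=
  ⨆ t : Icc (0 : ℝ) S.T, S.normL2 (u t)

/-- `‖u‖_{L²(0,T;ℍˢ(Ω))}`. -/
def normL2Hs (u : ℝ → Pt d → ℝ) : ℝ :=
  Real.sqrt (∫ t in Ioo 0 S.T, (S.normHg S.s (u t)) ^ 2)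

/-- `‖∇U‖_{L²(0,T;L²(y^α,Ω×I))}`. -/
def normL2grad (I : Set ℝ) (U : ℝ → Cy d → ℝ) : ℝ :=
  Real.sqrt (∫ t in Ioo 0 S.T, (S.gradNorm I (U t)) ^ 2)

/-- `‖∇U‖_{L∞(0,T;L²(y^α,Ω×I))}`. -/
def normLinfgrad (I : Set ℝ) (U : ℝ → Cy d → ℝ) : ℝ :=
  ⨆ t : Icc (0 : ℝ) S.T, S.gradNorm I (U t)

/-- The data functional `𝔇(u₀,f,ψ)`. -/
def DD (u₀ : Pt d → ℝ) (f : ℝ → Pt d → ℝ) (ψ : Pt d → ℝ) : ℝ :=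
  Real.sqrt ((S.normL2 u₀) ^ 2 + (S.normL2L2 f) ^ 2 + (S.normHg S.s ψ) ^ 2)

/-- The standing assumptions on the obstacle: `ψ ∈ ℍˢ(Ω) ∩ C(Ω̄)` and `ψ ≤ 0` on `∂Ω`. -/
def ObstacleData (ψ : Pt d → ℝ) : Prop :=
  ψ ∈ S.Hg S.s ∧ ContinuousOn ψ (closure S.Ω) ∧ ∀ x ∈ frontier S.Ω, ψ x ≤ 0

/-- `u` solves the parabolic fractional obstacle problem (evolution variational
inequality) with time derivative `u'`, data `u₀`, `f`, obstacle `ψ`. -/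
def SolVI (ψ u₀ : Pt d → ℝ) (f u u' : ℝ → Pt d → ℝ) : Prop :=
  (∀ t ∈ Icc (0 : ℝ) S.T, u t ∈ S.Kdom ψ) ∧ u 0 = u₀ ∧
  (∀ x ∈ S.Ω, ∀ t ∈ Ioo (0 : ℝ) S.T, HasDerivAt (fun r => u r x) (u' t x) t) ∧
  (∀ᵐ t ∂(volume.restrict (Ioo (0 : ℝ) S.T)), ∀ φ ∈ S.Kdom ψ,
    S.ipL2 (u' t) (u t - φ) + S.pair (S.fracLap (u t)) (u t - φ)
      ≤ S.ipL2 (f t) (u t - φ))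

/-- `U` solves the extended parabolic obstacle problem on the semi-infinite cylinder. -/
def SolExt (ψ u₀ : Pt d → ℝ) (f : ℝ → Pt d → ℝ) (U U' : ℝ → Cy d → ℝ) : Prop :=
  (∀ t ∈ Icc (0 : ℝ) S.T, U t ∈ S.Kfull ψ) ∧ trc (U 0) = u₀ ∧
  (∀ p ∈ S.Ω ×ˢ Ici (0 : ℝ), ∀ t ∈ Ioo (0 : ℝ) S.T, HasDerivAt (fun r => U r p) (U' t p) t) ∧
  (∀ᵐ t ∂(volume.restrict (Ioo (0 : ℝ) S.T)), ∀ φ ∈ S.Kfull ψ,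
    S.ipL2 (trc (U' t)) (trc (U t) - trc φ) + S.aForm (Ioi 0) (U t) (U t - φ)
      ≤ S.ipL2 (f t) (trc (U t) - trc φ))

/-- `V` solves the truncated parabolic obstacle problem on `𝒞_Y`. -/
def SolTrunc (Y : ℝ) (ψ u₀ : Pt d → ℝ) (f : ℝ → Pt d → ℝ) (V V' : ℝ → Cy d → ℝ) : Prop :=
  (∀ t ∈ Icc (0 : ℝ) S.T, V t ∈ S.Ktrunc Y ψ) ∧ trc (V 0) = u₀ ∧
  (∀ p ∈ S.Ω ×ˢ Icc (0 : ℝ) Y, ∀ t ∈ Ioo (0 : ℝ) S.T, HasDerivAt (fun r => V r p) (V' t p) t) ∧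
  (∀ᵐ t ∂(volume.restrict (Ioo (0 : ℝ) S.T)), ∀ φ ∈ S.Ktrunc Y ψ,
    S.ipL2 (trc (V' t)) (trc (V t) - trc φ) + S.aForm (Ioo 0 Y) (V t) (V t - φ)
      ≤ S.ipL2 (f t) (trc (V t) - trc φ))

/-- Time averages `f^k = τ⁻¹ ∫_{t_{k-1}}^{t_k} f dt`, `τ = T/K`. -/
def favg (f : ℝ → Pt d → ℝ) (K : ℕ) (k : ℕ) : Pt d → ℝ :=
  fun x => ((K : ℝ) / S.T) *
    ∫ t in Ioo (((k : ℝ) - 1) * (S.T / K)) ((k : ℝ) * (S.T / K)), f t x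

/-- The semidiscrete (implicit Euler) scheme on `𝒞_Y`:  `V^{k+1} ∈ 𝒦(𝒞_Y)` solves the
discrete variational inequality with right-hand sides `fd (k+1)`, for `k < K`. -/
def Scheme (Y : ℝ) (ψ u₀ : Pt d → ℝ) (fd : ℕ → Pt d → ℝ) (K : ℕ) (V : ℕ → Cy d → ℝ) : Prop :=
  trc (V 0) = u₀ ∧
  ∀ k < K, V (k + 1) ∈ S.Ktrunc Y ψ ∧
    ∀ φ ∈ S.Ktrunc Y ψ,
      S.ipL2 (fun x => (trc (V (k + 1)) x - trc (V k) x) / (S.T / K))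
          (trc (V (k + 1)) - trc φ)
        + S.aForm (Ioo 0 Y) (V (k + 1)) (V (k + 1) - φ)
        ≤ S.ipL2 (fd (k + 1)) (trc (V (k + 1)) - trc φ)

/-- The fully discrete scheme over a discrete admissible set `KT ⊆ 𝒦(𝒞_Y)`. -/
def SchemeD (Y : ℝ) (KT : Set (Cy d → ℝ)) (fd : ℕ → Pt d → ℝ) (K : ℕ)
    (V : ℕ → Cy d → ℝ) : Prop :=
  ∀ k < K, V (k + 1) ∈ KT ∧
    ∀ W ∈ KT,
      S.ipL2 (fun x => (trc (V (k + 1)) x - trc (V k) x) / (S.T / K))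
          (trc (V (k + 1)) - trc W)
        + S.aForm (Ioo 0 Y) (V (k + 1)) (V (k + 1) - W)
        ≤ S.ipL2 (fd (k + 1)) (trc (V (k + 1)) - trc W)

/-- The set of partial-variation sums of `f : [0,T] → L²(Ω)`. -/
def VarSet (f : ℝ → Pt d → ℝ) : Set ℝ :=
  {v | ∃ (n : ℕ) (r : ℕ → ℝ), r 0 = 0 ∧ r n = S.T ∧ (∀ j < n, r j < r (j + 1)) ∧
        v = ∑ j ∈ Finset.range n, S.normL2 (f (r (j + 1)) - f (r j))}

/-- `f ∈ BV(0,T;L²(Ω))`. -/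
def IsBV (f : ℝ → Pt d → ℝ) : Prop := BddAbove (S.VarSet f)

/-- `Var_{L²(Ω)} f`. -/
def VarL2 (f : ℝ → Pt d → ℝ) : ℝ := sSup (S.VarSet f)

/-- `g` is the right limit `f₊(t₀)` of `f` at `t₀` in `L²(Ω)`. -/
def RightLim (f : ℝ → Pt d → ℝ) (t₀ : ℝ) (g : Pt d → ℝ) : Prop :=
  Filter.Tendsto (fun t => S.normL2 (f t - g)) (nhdsWithin t₀ (Ioi t₀)) (nhds 0)

/-- `‖∇∇_{x'} w‖_{L²(y^α,𝒞_Y)}`. -/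
def normGradGradX (Y : ℝ) (w : Cy d → ℝ) : ℝ :=
  Real.sqrt (∫ p in S.Ω ×ˢ Ioo 0 Y, p.2 ^ S.α *
    ((∑ i, ∑ j, (D2 w p (ex i) (ex j)) ^ 2) + ∑ i, (D2 w p (ex i) ey) ^ 2))

/-- `‖∂_{yy} w‖_{L²(y^β,𝒞_Y)}`. -/
def normYY (Y β : ℝ) (w : Cy d → ℝ) : ℝ :=
  Real.sqrt (∫ p in S.Ω ×ˢ Ioo 0 Y, p.2 ^ β * (D2 w p ey ey) ^ 2)

/-- The `H²(y^β,𝒞_Y)` (second order) seminorm. -/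
def normH2 (Y β : ℝ) (w : Cy d → ℝ) : ℝ :=
  Real.sqrt (∫ p in S.Ω ×ˢ Ioo 0 Y, p.2 ^ β *
    ((∑ i, ∑ j, (D2 w p (ex i) (ex j)) ^ 2) + 2 * ∑ i, (D2 w p (ex i) ey) ^ 2 +
      (D2 w p ey ey) ^ 2))

/-- `W = ℋ_α φ` is the truncated `α`-harmonic extension of `φ` to `𝒞_Y`. -/
def IsHarmExt (Y : ℝ) (φ : Pt d → ℝ) (W : Cy d → ℝ) : Prop :=
  W ∈ S.HLtrunc Y ∧ S.alphaHarmonic Y W ∧ trc W = φ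

end Setting

/-- A smoothing kernel `μ₁ ∈ C_c^∞(ℝ^d)`: nonnegative, with unit mass and vanishing
first order moments. -/
structure Kernel (d : ℕ) where
  μ1 : Pt d → ℝ
  smooth : ContDiff ℝ (⊤ : ℕ∞) μ1
  cpt : HasCompactSupport μ1
  nonneg : ∀ x, 0 ≤ μ1 x
  mass : (∫ x, μ1 x) = 1
  moments : ∀ i : Fin d, (∫ x, μ1 x * x i) = 0

/-- The rescaled kernel `μ_{1,v'}(x') = h_{v'}^{-d} μ₁((x'−v')/h_{v'})`. -/
def Kernel.scaled {d : ℕ} (κ : Kernel d) (v : Pt d) (h : ℝ) : Pt d → ℝ :=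
  fun x => (h ^ d)⁻¹ * κ.μ1 (h⁻¹ • (x - v))

/-- Abstract data of a conforming spatial mesh `𝒯_Ω`: its (interior) nodes `v'`,
local mesh sizes `h_{v'}` and the associated nonnegative piecewise (multi)linear
Lagrange basis functions `Λ_{v'}`. -/
structure MeshΩ (d : ℕ) where
  n : ℕ
  node : Fin n → Pt d
  h : Fin n → ℝ
  hpos : ∀ i, 0 < h i
  Λ : Fin n → Pt d → ℝ
  Λnonneg : ∀ i x, 0 ≤ Λ i x
  Λdelta : ∀ i j, Λ i (node j) = if i = j then 1 else 0

/-- The positivity preserving operator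
`ℛ_{𝒯_Ω} φ = Σ_{v'} (∫ μ_{1,v'}(z') φ(z') dz') Λ_{v'}`. -/
def Rop {d : ℕ} (m : MeshΩ d) (κ : Kernel d) (φ : Pt d → ℝ) : Pt d → ℝ :=
  fun x => ∑ i, (∫ z, κ.scaled (m.node i) (m.h i) z * φ z) * m.Λ i x

theorem Kernel.scaled_nonneg {d : ℕ} (κ : Kernel d) {v : Pt d} {h : ℝ} (hh : 0 ≤ h) (x : Pt d) :
    0 ≤ κ.scaled v h x :=
  mul_nonneg (inv_nonneg.2 (pow_nonneg hh d)) (κ.nonneg _)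

/-- positivity preservation of the interpolant.  The operator
`Π_{𝒯_𝒴}`, defined nodewise by `𝓛_{𝒯_𝒴}` at nodes with `v″ > 0` and by `ℛ_{𝒯_Ω}`
applied to `w(·,0)` at the nodes on `Ω×{0}` (so that `tr Π_{𝒯_𝒴} w = ℛ_{𝒯_Ω}(tr w)`),
preserves nonnegativity of traces: if `tr w ≥ 0` a.e. in `Ω` then `tr Π_{𝒯_𝒴} w ≥ 0`
in `Ω`; indeed `μ₁ ≥ 0` forces every nodal value
`ℛ_{𝒯_Ω}(tr w)(v') = ∫ μ_{1,v'} tr w` to be nonnegative and the Lagrange basis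
functions are nonnegative. -/
theorem interpolant_positivity {d : ℕ} (S : Setting d) (m : MeshΩ d) (κ : Kernel d)
    (w : Cy d → ℝ) (Ip : (Cy d → ℝ) → (Cy d → ℝ))
    -- the rescaled kernels are supported inside the corresponding stars in `Ω`
    (hsupp : ∀ i, Function.support (κ.scaled (m.node i) (m.h i)) ⊆ S.Ω)
    -- the trace of `Π_{𝒯_𝒴} w` is `ℛ_{𝒯_Ω}` applied to the trace of `w`
    (hIptr : ∀ x, trc (Ip w) x = Rop m κ (trc w) x)
    -- `tr w ≥ 0` a.e. in `Ω`
    (hw : ∀ᵐ x ∂S.μΩ, 0 ≤ trc w x) :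
    ∀ x ∈ S.Ω, 0 ≤ trc (Ip w) x := by
  intro x _
  rw [hIptr x]
  refine Finset.sum_nonneg fun i _ => mul_nonneg ?_ (m.Λnonneg i x)
  apply integral_nonneg_of_ae
  filter_upwards [(ae_restrict_iff' S.hΩop.measurableSet).1 hw] with z hz
  by_cases hzΩ : z ∈ S.Ω
  · exact mul_nonneg (κ.scaled_nonneg (m.hpos i).le z) (hz hzΩ)
  · simp [Function.notMem_support.1 fun h => hzΩ (hsupp i h)]
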